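/- Suppose F is immersed in G under P, and let Q be a probability measure equivalent to P on 𝒢 whose density ρ = dQ/dP is F_∞-measurable. Then for all 0 ≤ s ≤ t, Q(τ > s | F_t) = P(τ > s | F_t) Q-almost surely (equivalently P-almost surely); in particular the Azéma supermartingale of τ is the same under Q as under P. -/

import Mathlib

open MeasureTheory Set
open scoped NNReal ENNReal

noncomputable section

namespace DefaultTimes

variable {Ω : Type*}

/-- The progressively enlarged filtration
`G_t = ⋂_{u>t} (F_u ∨ σ(τ ∧ s : s ≤ u))`. -/
def enlargedFiltration {m0 : MeasurableSpace Ω}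
    (F : Filtration ℝ≥0 m0) (τ : Ω → ℝ≥0∞) (hτ : Measurable τ) :
    Filtration ℝ≥0 m0 where
  seq t := ⨅ u ∈ Set.Ioi t, (F u ⊔ ⨆ s ∈ Set.Iic u,
      MeasurableSpace.comap (fun ω => min (τ ω) (s : ℝ≥0∞)) inferInstance)
  mono' := fun i j hij => le_iInf₂ fun u hu => iInf₂_le u (lt_of_le_of_lt hij hu)
  le' := fun t => by
    refine le_trans (iInf₂_le (t + 1) (lt_add_of_pos_right t one_pos)) ?_
    exact sup_le (Filtration.le _ _)
      (iSup₂_le fun s _ => Measurable.comap_le (hτ.min measurable_const))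

/-- `F` is immersed in `G` under `μ` ((H)-hypothesis): every `(F,μ)`-martingale is
a `(G,μ)`-martingale. -/
def Immersion {m0 : MeasurableSpace Ω} (F G : Filtration ℝ≥0 m0) (μ : Measure Ω) : Prop :=
  ∀ f : ℝ≥0 → Ω → ℝ, Martingale f F μ → Martingale f G μ

open Filter Topology in
/-- If `F` is immersed in `G`, an `F_∞`-measurable integrable function and its projection on `F t`
have the same integrals over the events of `G t`. -/
theorem Immersion.setIntegral_condExp_eq {m0 : MeasurableSpace Ω} {P : Measure Ω}
    [IsFiniteMeasure P] {F G : Filtration ℝ≥0 m0} (hFG : Immersion F G P) {ρ : Ω → ℝ}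
    (hρ_meas : Measurable[⨆ u, F u] ρ) (hρ_int : Integrable ρ P) (t : ℝ≥0) {C : Set Ω}
    (hC : MeasurableSet[G t] C) :
    ∫ ω in C, (P[ρ|F t]) ω ∂P = ∫ ω in C, ρ ω ∂P := by
  have hmart : Martingale (fun u => P[ρ|F u]) G P := hFG _ (martingale_condExp ρ F P)
  let FN : Filtration ℕ m0 :=
    { seq := fun n => F n
      mono' := fun i j hij => F.mono (Nat.cast_le.mpr hij)
      le' := fun n => F.le n }
  have hsup : (⨆ u, F u) ≤ ⨆ n, FN n := iSup_le fun u => by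
    obtain ⟨n, hn⟩ := exists_nat_ge u
    exact (F.mono hn).trans (le_iSup (fun n => FN n) n)
  have hlim := hρ_int.tendsto_eLpNorm_condExp (ℱ := FN)
    (hρ_meas.mono hsup le_rfl).stronglyMeasurable
  have hlim' := tendsto_setIntegral_of_L1' ρ hρ_int.aestronglyMeasurable
    (Eventually.of_forall fun n => integrable_condExp) hlim C
  refine tendsto_nhds_unique (tendsto_const_nhds.congr' ?_) hlim'
  obtain ⟨N, hN⟩ := exists_nat_ge t
  filter_upwards [eventually_ge_atTop N] with n hn
  exact hmart.setIntegral_eq (hN.trans (Nat.cast_le.mpr hn)) hC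

theorem measurableSet_lt_enlargedFiltration {m0 : MeasurableSpace Ω} (F : Filtration ℝ≥0 m0)
    (τ : Ω → ℝ≥0∞) (hτ : Measurable τ) {s t : ℝ≥0} (hst : s ≤ t) :
    MeasurableSet[enlargedFiltration F τ hτ t] {ω | (s : ℝ≥0∞) < τ ω} := by
  change MeasurableSet[⨅ u ∈ Set.Ioi t, (F u ⊔ ⨆ s ∈ Set.Iic u,
      MeasurableSpace.comap (fun ω => min (τ ω) (s : ℝ≥0∞)) inferInstance)] _
  simp only [MeasurableSpace.measurableSet_iInf]
  intro u hu
  have hle : MeasurableSpace.comap (fun ω => min (τ ω) (u : ℝ≥0∞)) inferInstance ≤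
      F u ⊔ ⨆ s ∈ Set.Iic u,
        MeasurableSpace.comap (fun ω => min (τ ω) (s : ℝ≥0∞)) inferInstance :=
    le_sup_of_le_right (le_iSup₂_of_le u (Set.mem_Iic.mpr le_rfl) le_rfl)
  refine hle _ ⟨Set.Ioi (s : ℝ≥0∞), measurableSet_Ioi, ?_⟩
  ext ω
  have hsu : (s : ℝ≥0∞) < u := ENNReal.coe_lt_coe.mpr (hst.trans_lt hu)
  simp [hsu]

/-- The conditional probability of `A` given `m` is unchanged by a change of measure whose
density has the same integrals as its projection on `m` over the events `B ∩ A`, `B ∈ m`. -/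
theorem condExp_indicator_withDensity {m m0 : MeasurableSpace Ω} (hm : m ≤ m0) {P : Measure Ω}
    [IsFiniteMeasure P] {ρ : Ω → ℝ} (hρ_meas : Measurable ρ) (hρ_pos : ∀ ω, 0 < ρ ω)
    (hρ_int : Integrable ρ P) {A : Set Ω} (hA : MeasurableSet A)
    (hproj : ∀ B, MeasurableSet[m] B →
      ∫ ω in B ∩ A, (P[ρ|m]) ω ∂P = ∫ ω in B ∩ A, ρ ω ∂P) :
    (P.withDensity fun ω => ENNReal.ofReal (ρ ω))[A.indicator (fun _ => (1 : ℝ))|m]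
      =ᵐ[P] P[A.indicator (fun _ => (1 : ℝ))|m] := by
  set Q := P.withDensity fun ω => ENNReal.ofReal (ρ ω) with hQ
  set Z := P[A.indicator (fun _ => (1 : ℝ))|m] with hZ
  have : IsFiniteMeasure Q := isFiniteMeasure_withDensity_ofReal hρ_int.2
  have hQP : Q ≪ P := withDensity_absolutelyContinuous _ _
  have hPQ : P ≪ Q := withDensity_absolutelyContinuous' hρ_meas.ennreal_ofReal.aemeasurable
    (Filter.Eventually.of_forall fun ω => by simpa using hρ_pos ω)
  have hint : Integrable (A.indicator (fun _ => (1 : ℝ))) P :=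
    (integrable_const _).indicator hA
  have hZm : StronglyMeasurable[m] Z := stronglyMeasurable_condExp
  have hZbound : ∀ᵐ ω ∂P, ‖Z ω‖ ≤ 1 := by
    refine ae_bdd_abs_condExp_of_ae_bdd_abs (R := (1 : ℝ)) (Filter.Eventually.of_forall fun ω => ?_)
    by_cases h : ω ∈ A <;> simp [h]
  have hQset : ∀ (f : Ω → ℝ) (B : Set Ω), MeasurableSet B →
      ∫ ω in B, f ω ∂Q = ∫ ω in B, ρ ω * f ω ∂P := fun f B hB => by
    rw [hQ, setIntegral_withDensity_eq_setIntegral_toReal_smul hρ_meas.ennreal_ofReal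
      (Filter.Eventually.of_forall fun ω => ENNReal.ofReal_lt_top) f hB]
    simp [ENNReal.toReal_ofReal (hρ_pos _).le]
  have hρA : ∀ (g : Ω → ℝ) (B : Set Ω),
      ∫ ω in B, g ω * A.indicator (fun _ => (1 : ℝ)) ω ∂P = ∫ ω in B ∩ A, g ω ∂P := by
    intro g B
    rw [← setIntegral_indicator hA]
    congr 1 with ω
    by_cases h : ω ∈ A <;> simp [h]
  have hρZ : Integrable (ρ * Z) P :=
    hρ_int.mul_bdd (c := 1) (hZm.mono hm).aestronglyMeasurable hZbound
  have hMA : Integrable (P[ρ|m] * A.indicator (fun _ => (1 : ℝ))) P :=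
    integrable_condExp.mul_bdd (c := 1) hint.aestronglyMeasurable
      (Filter.Eventually.of_forall fun ω => by by_cases h : ω ∈ A <;> simp [h])
  refine (hPQ.ae_eq (ae_eq_condExp_of_forall_setIntegral_eq hm
    ((integrable_const _).indicator hA) (fun B _ _ => ?_) (fun B hB _ => ?_)
    hZm.aestronglyMeasurable)).symm
  · exact (Integrable.of_bound (hZm.mono hm).aestronglyMeasurable 1
      (hQP.ae_le hZbound)).integrableOn
  · rw [hQset _ _ (hm _ hB), hQset _ _ (hm _ hB), hρA, ← hproj B hB, ← hρA]
    calc ∫ ω in B, ρ ω * Z ω ∂P = ∫ ω in B, (P[ρ * Z|m]) ω ∂P :=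
          (setIntegral_condExp hm hρZ hB).symm
      _ = ∫ ω in B, (P[P[ρ|m] * A.indicator (fun _ => (1 : ℝ))|m]) ω ∂P := by
          refine integral_congr_ae (ae_restrict_of_ae ?_)
          exact (condExp_mul_of_stronglyMeasurable_right hZm hρZ hρ_int).trans
            (condExp_mul_of_stronglyMeasurable_left stronglyMeasurable_condExp hMA hint).symm
      _ = ∫ ω in B, (P[ρ|m]) ω * A.indicator (fun _ => (1 : ℝ)) ω ∂P :=
          setIntegral_condExp hm hMA hB

theorem le_enlargedFiltration {m0 : MeasurableSpace Ω} (F : Filtration ℝ≥0 m0)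
    (τ : Ω → ℝ≥0∞) (hτ : Measurable τ) : F ≤ enlargedFiltration F τ hτ :=
  fun _ => le_iInf₂ fun _ hu => le_sup_of_le_left (F.mono (le_of_lt hu))

theorem stmt_4 {m0 : MeasurableSpace Ω} (P : Measure Ω) [IsProbabilityMeasure P]
    (F : Filtration ℝ≥0 m0) (τ : Ω → ℝ≥0∞) (hτ : Measurable τ)
    (hImm : Immersion F (enlargedFiltration F τ hτ) P)
    (ρ : Ω → ℝ) (hρ_meas : Measurable[⨆ u, F u] ρ) (hρ_pos : ∀ ω, 0 < ρ ω)
    (hρ_int : Integrable ρ P) (hρ_one : ∫ ω, ρ ω ∂P = 1)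
    (Q : Measure Ω) (hQ : Q = P.withDensity fun ω => ENNReal.ofReal (ρ ω)) :
    ∀ s t : ℝ≥0, s ≤ t →
      Q[Set.indicator {ω | (s : ℝ≥0∞) < τ ω} (fun _ => (1 : ℝ))|F t]
        =ᵐ[P] P[Set.indicator {ω | (s : ℝ≥0∞) < τ ω} (fun _ => (1 : ℝ))|F t] := by
  intro s t hst
  subst hQ
  have hA := measurableSet_lt_enlargedFiltration F τ hτ hst
  exact condExp_indicator_withDensity (F.le t) (hρ_meas.mono (iSup_le F.le) le_rfl) hρ_pos
    hρ_int ((enlargedFiltration F τ hτ).le t _ hA) fun B hB =>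
      hImm.setIntegral_condExp_eq hρ_meas hρ_int t
        (MeasurableSet.inter (le_enlargedFiltration F τ hτ t _ hB) hA)

end DefaultTimes
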